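/- Let H be an object in a category 𝕏 with finite biproducts such that the identity 1_H : H → H has an additive inverse −1_H (i.e. 1_H + (−1_H) = 0). Consider the monad T(−) := H ⊕ − with multiplication μ_A := ι₁ ∘ π₁ + ι₁ ∘ π₂ + ι₂ ∘ π₃ : H ⊕ H ⊕ A → H ⊕ A and unit η_A := ι₂ : A → H ⊕ A. Then this monad is a Hopf monad and its fusion invertor h°_A : H ⊕ A → H ⊕ A ⊕ H ⊕ 𝟘 is given by h°_A = ι₁ ∘ π₁ + ι₂ ∘ π₂ + ι₃ ∘ (−1_H) ∘ π₁. -/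

import Mathlib

/-!
Hopf monads on a category with finite biproducts (Bruguières–Lack–Virelizier style),
following "Hopf Monads on Biproducts".

Setting: `C` is a category with a zero object and binary biproducts (hence zero
morphisms), so that each hom-set carries the commutative monoid structure induced by
the biproducts.  `badd f g` is the induced addition of parallel maps.
-/

namespace HopfBiproducts

open CategoryTheory CategoryTheory.Limits ZeroObject

universe v u

variable {C : Type u} [Category.{v} C] [HasZeroObject C] [HasZeroMorphisms C]
  [HasBinaryBiproducts C]

/-- The addition of parallel maps induced by binary biproducts:
`f + g = ⟨f, g⟩ ≫ [1, 1]`. -/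
noncomputable def badd {X Y : C} (f g : X ⟶ Y) : X ⟶ Y :=
  biprod.lift f g ≫ biprod.desc (𝟙 Y) (𝟙 Y)

/-- The fusion operator `h_{A,B} = ι₁ ∘ T(π₁) + ι₂ ∘ μ_B ∘ T(π₂)` of a monad on a
category with finite biproducts. -/
noncomputable def fusion (T : Monad C) (A B : C) :
    T.obj (A ⊞ T.obj B) ⟶ T.obj A ⊞ T.obj B :=
  badd (T.map biprod.fst ≫ biprod.inl) (T.map biprod.snd ≫ T.μ.app B ≫ biprod.inr)


/-- A *fusion invertor* for a monad `(T, μ, η)` on a category with finite biproducts: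
a natural transformation `h°_A : T(A) ⟶ T(A ⊕ T(𝟘))` satisfying
[FI.1] `T(π₁) ∘ h°_A = 1`, [FI.2] `μ_𝟘 ∘ T(π₂) ∘ h°_A = 0`, and
[FI.3] `T(1_A ⊕ T(0)) ∘ h°_A ∘ T(π₁) + T(ι₂) ∘ η_{T(B)} ∘ μ_B ∘ T(π₂) = 1` for all `B`. -/
structure FusionInvertor (T : Monad C) where
  /-- the component `h°_A : T(A) ⟶ T(A ⊕ T(𝟘))` -/
  app : ∀ A : C, T.obj A ⟶ T.obj (A ⊞ T.obj (0 : C))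
  naturality : ∀ {A A' : C} (f : A ⟶ A'),
    T.map f ≫ app A' = app A ≫ T.map (biprod.map f (𝟙 (T.obj (0 : C))))
  fi1 : ∀ A : C, app A ≫ T.map biprod.fst = 𝟙 (T.obj A)
  fi2 : ∀ A : C, app A ≫ T.map biprod.snd ≫ T.μ.app (0 : C) = 0
  fi3 : ∀ A B : C,
    badd (T.map biprod.fst ≫ app A ≫ T.map (biprod.map (𝟙 A) (T.map (0 : (0 : C) ⟶ B))))
        (T.map biprod.snd ≫ T.μ.app B ≫ T.η.app (T.obj B) ≫ T.map biprod.inr) =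
      𝟙 (T.obj (A ⊞ T.obj B))

theorem comp_badd {X Y Z : C} (f : X ⟶ Y) (g h : Y ⟶ Z) :
    f ≫ badd g h = badd (f ≫ g) (f ≫ h) := by
  unfold badd
  rw [← Category.assoc]
  congr 1
  apply biprod.hom_ext <;> simp

theorem badd_comp {X Y Z : C} (f g : X ⟶ Y) (h : Y ⟶ Z) :
    badd f g ≫ h = badd (f ≫ h) (g ≫ h) := by
  unfold badd
  have e : biprod.lift (f ≫ h) (g ≫ h) = biprod.lift f g ≫ biprod.map h h := by
    apply biprod.hom_ext <;> simp
  rw [e, Category.assoc, Category.assoc]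
  congr 1
  apply biprod.hom_ext' <;> simp

theorem badd_zero' {X Y : C} (f : X ⟶ Y) : badd f 0 = f := by
  unfold badd
  have e : biprod.lift f (0 : X ⟶ Y) = f ≫ biprod.inl := by
    apply biprod.hom_ext <;> simp
  rw [e, Category.assoc, biprod.inl_desc, Category.comp_id]

theorem zero_badd' {X Y : C} (g : X ⟶ Y) : badd 0 g = g := by
  unfold badd
  have e : biprod.lift (0 : X ⟶ Y) g = g ≫ biprod.inr := by
    apply biprod.hom_ext <;> simp
  rw [e, Category.assoc, biprod.inr_desc, Category.comp_id]

theorem badd_total (X Y : C) :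
    badd (biprod.fst ≫ biprod.inl) (biprod.snd ≫ biprod.inr) = 𝟙 (X ⊞ Y) := by
  apply biprod.hom_ext
  · rw [badd_comp]; simp [badd_zero']
  · rw [badd_comp]; simp [zero_badd']

/-- The multiplication `μ_A := ι₁ ∘ π₁ + ι₁ ∘ π₂ + ι₂ ∘ π₃ : H ⊕ H ⊕ A ⟶ H ⊕ A` of
the representable monad `H ⊕ −`. -/
noncomputable def muF (H A : C) : H ⊞ (H ⊞ A) ⟶ H ⊞ A :=
  badd (badd (biprod.fst ≫ biprod.inl) ((biprod.snd ≫ biprod.fst) ≫ biprod.inl))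
    ((biprod.snd ≫ biprod.snd) ≫ biprod.inr)

theorem muF_eq (H A : C) : muF H A = biprod.desc biprod.inl (𝟙 (H ⊞ A)) := by
  apply biprod.hom_ext'
  · rw [muF, comp_badd, comp_badd]
    simp [badd_zero']
  · rw [muF, comp_badd, comp_badd]
    simp [zero_badd', badd_total]

/-- The representable monad `T(−) := H ⊕ −` on a category with finite biproducts,
with unit `η_A := ι₂` and multiplication `μ_A := ι₁ ∘ π₁ + ι₁ ∘ π₂ + ι₂ ∘ π₃`. -/
noncomputable def biprodMonad (H : C) : Monad C where
  obj A := H ⊞ A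
  map f := biprod.map (𝟙 H) f
  map_id A := by apply biprod.hom_ext <;> simp
  map_comp f g := by apply biprod.hom_ext <;> simp
  η :=
    { app := fun A => (biprod.inr : A ⟶ H ⊞ A)
      naturality := fun A B f => by dsimp; simp }
  μ :=
    { app := fun A => muF H A
      naturality := fun A B f => by
        dsimp
        rw [muF_eq, muF_eq]
        apply biprod.hom_ext' <;> simp }
  assoc X := by
    dsimp
    rw [muF_eq, muF_eq]
    apply biprod.hom_ext' <;> simp
  left_unit X := by
    dsimp
    rw [muF_eq]
    simp
  right_unit X := by
    dsimp
    rw [muF_eq]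
    apply biprod.hom_ext' <;> simp

theorem biprod_lift_desc_eq_badd {W X Y Z : C} (f : W ⟶ X) (g : W ⟶ Y) (h : X ⟶ Z)
    (k : Y ⟶ Z) : biprod.lift f g ≫ biprod.desc h k = badd (f ≫ h) (g ≫ k) := by
  have e : biprod.lift (f ≫ h) (g ≫ k) = biprod.lift f g ≫ biprod.map h k := by
    apply biprod.hom_ext <;> simp
  unfold badd
  rw [e, Category.assoc]
  congr 1
  apply biprod.hom_ext' <;> simp

theorem biprod_lift_desc_assoc_eq_badd {V W X Y Z : C} (f : W ⟶ X) (g : W ⟶ Y) (h : X ⟶ Z)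
    (k : Y ⟶ Z) (t : Z ⟶ V) :
    biprod.lift f g ≫ biprod.desc h k ≫ t = badd (f ≫ h ≫ t) (g ≫ k ≫ t) := by
  rw [← Category.assoc, biprod_lift_desc_eq_badd, badd_comp, Category.assoc, Category.assoc]

theorem biprod_lift_map_assoc {V W X X' Y Y' : C} (f : W ⟶ X) (g : W ⟶ Y) (h : X ⟶ X')
    (k : Y ⟶ Y') (t : X' ⊞ Y' ⟶ V) :
    biprod.lift f g ≫ biprod.map h k ≫ t = biprod.lift (f ≫ h) (g ≫ k) ≫ t := by
  rw [← Category.assoc]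
  congr 1
  apply biprod.hom_ext <;> simp

theorem badd_comm {X Y : C} (f g : X ⟶ Y) : badd f g = badd g f := by
  unfold badd
  have e : biprod.lift g f = biprod.lift f g ≫ biprod.lift biprod.snd biprod.fst := by
    apply biprod.hom_ext <;> simp
  rw [e, Category.assoc]
  congr 1
  apply biprod.hom_ext' <;> simp [biprod_lift_desc_eq_badd, comp_badd, badd_zero', zero_badd']

/-- The fusion operator of `H ⊕ −` sends `(h, a, k, b)` to `(h, a, h + k, b)`. -/
theorem fusion_biprodMonad (H A B : C) :
    fusion (biprodMonad H) A B =
      (biprod.desc (biprod.lift biprod.inl biprod.inl) (biprod.map biprod.inr (𝟙 (H ⊞ B))) :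
        H ⊞ (A ⊞ (H ⊞ B)) ⟶ (H ⊞ A) ⊞ (H ⊞ B)) := by
  change badd (biprod.map (𝟙 H) biprod.fst ≫ biprod.inl)
    (biprod.map (𝟙 H) biprod.snd ≫ muF H B ≫ biprod.inr) = _
  rw [muF_eq]
  apply biprod.hom_ext <;> apply biprod.hom_ext' <;>
    simp [badd_comp, badd_zero', zero_badd']

/-- The inverse `(h, a, k, b) ↦ (h, a, k - h, b)` of the fusion operator of `H ⊕ −`. -/
noncomputable def fusionInv {H : C} (negH : H ⟶ H) (A B : C) :
    (H ⊞ A) ⊞ (H ⊞ B) ⟶ H ⊞ (A ⊞ (H ⊞ B)) :=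
  biprod.desc
    (biprod.desc (biprod.lift (𝟙 H) (negH ≫ biprod.inl ≫ biprod.inr)) (biprod.inl ≫ biprod.inr))
    (biprod.inr ≫ biprod.inr)

theorem isIso_fusion_biprodMonad {H : C} {negH : H ⟶ H} (hneg : badd (𝟙 H) negH = 0) (A B : C) :
    IsIso (fusion (biprodMonad H) A B) := by
  rw [fusion_biprodMonad]
  let φ : H ⊞ (A ⊞ (H ⊞ B)) ⟶ (H ⊞ A) ⊞ (H ⊞ B) :=
    biprod.desc (biprod.lift biprod.inl biprod.inl) (biprod.map biprod.inr (𝟙 (H ⊞ B)))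
  have hφ : φ ≫ fusionInv negH A B = 𝟙 (H ⊞ (A ⊞ (H ⊞ B))) := by
    unfold φ fusionInv
    repeat' first | apply biprod.hom_ext | apply biprod.hom_ext'
    all_goals simp [badd_zero', biprod_lift_desc_assoc_eq_badd, hneg, badd_comm negH]
  have hψ : fusionInv negH A B ≫ φ = 𝟙 ((H ⊞ A) ⊞ (H ⊞ B)) := by
    unfold φ fusionInv
    repeat' first | apply biprod.hom_ext | apply biprod.hom_ext'
    all_goals simp [badd_zero', biprod_lift_desc_assoc_eq_badd, hneg]
  exact ⟨fusionInv negH A B, hφ, hψ⟩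

/-- The fusion invertor `(h, a) ↦ (h, a, -h, 0)` of `H ⊕ −`. -/
noncomputable def biprodMonadFusionInvertor {H : C} (negH : H ⟶ H)
    (hneg : badd (𝟙 H) negH = 0) : FusionInvertor (biprodMonad H) where
  app A := biprod.inl ≫ fusionInv negH A 0
  naturality {A A'} f := by
    change biprod.map (𝟙 H) f ≫ biprod.inl ≫ fusionInv negH A' 0 =
      (biprod.inl ≫ fusionInv negH A 0) ≫
        biprod.map (𝟙 H) (biprod.map f (𝟙 (H ⊞ (0 : C))))
    unfold fusionInv
    repeat' first | apply biprod.hom_ext | apply biprod.hom_ext'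
    all_goals simp
  fi1 A := by
    change (biprod.inl ≫ fusionInv negH A 0) ≫ biprod.map (𝟙 H) biprod.fst = 𝟙 (H ⊞ A)
    unfold fusionInv
    repeat' first | apply biprod.hom_ext | apply biprod.hom_ext'
    all_goals simp
  fi2 A := by
    change (biprod.inl ≫ fusionInv negH A 0) ≫ biprod.map (𝟙 H) biprod.snd ≫ muF H 0 = 0
    rw [muF_eq]
    unfold fusionInv
    repeat' first | apply biprod.hom_ext | apply biprod.hom_ext'
    all_goals simp [badd_zero', biprod_lift_desc_assoc_eq_badd, biprod_lift_map_assoc, hneg]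
  fi3 A B := by
    change badd (biprod.map (𝟙 H) biprod.fst ≫ (biprod.inl ≫ fusionInv negH A 0) ≫
        biprod.map (𝟙 H) (biprod.map (𝟙 A) (biprod.map (𝟙 H) (0 : (0 : C) ⟶ B))))
      (biprod.map (𝟙 H) biprod.snd ≫ muF H B ≫ biprod.inr ≫ biprod.map (𝟙 H) biprod.inr) =
      𝟙 (H ⊞ (A ⊞ (H ⊞ B)))
    rw [muF_eq]
    unfold fusionInv
    repeat' first | apply biprod.hom_ext | apply biprod.hom_ext'
    all_goals simp [badd_comp, comp_badd, badd_zero', zero_badd', hneg, badd_comm negH]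

/-- if the identity of `H` has an additive inverse `-1_H` (so `H` is a
Hopf monoid), then the representable monad `H ⊕ −` is a Hopf monad, and its fusion
invertor `h°_A : H ⊕ A ⟶ H ⊕ A ⊕ H ⊕ 𝟘` is `ι₁ ∘ π₁ + ι₂ ∘ π₂ + ι₃ ∘ (-1_H) ∘ π₁`. -/
theorem biprodMonad_isHopf (H : C) (negH : H ⟶ H) (hneg : badd (𝟙 H) negH = 0) :
    (∀ A B : C, IsIso (fusion (biprodMonad H) A B)) ∧
    ∃ hc : FusionInvertor (biprodMonad H), ∀ A : C,
      hc.app A =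
        badd (badd ((biprod.fst : H ⊞ A ⟶ H) ≫ biprod.inl)
            ((biprod.snd : H ⊞ A ⟶ A) ≫ (biprod.inl : A ⟶ A ⊞ (H ⊞ (0 : C))) ≫ biprod.inr))
          ((biprod.fst : H ⊞ A ⟶ H) ≫ negH ≫ (biprod.inl : H ⟶ H ⊞ (0 : C)) ≫
            biprod.inr ≫ biprod.inr) := by
  refine ⟨isIso_fusion_biprodMonad hneg, biprodMonadFusionInvertor negH hneg, fun A => ?_⟩
  change biprod.inl ≫ fusionInv negH A 0 = _
  unfold fusionInv
  repeat' first | apply biprod.hom_ext | apply biprod.hom_ext'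
  all_goals simp [badd_comp, badd_zero', zero_badd']

end HopfBiproducts
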